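/- (i) If S is a dyadic subbase of X, then X̃ is a dense subset of D_S (with the subspace topology of 𝕋^ω). (ii) If S is moreover proper, then X̃ is a dense subset of D̂_S. (Proposition 4.2) -/

import Mathlib

open Set Topology TopologicalSpace

/-- The three-element set 𝕋 = {0, 1, ⊥}. `digit b` is a digit (0 or 1), `bot` is ⊥. -/
inductive TT where
  | bot : TT
  | digit : Bool → TT
  deriving DecidableEq

/-- The topology on 𝕋 whose open sets are ∅, {0}, {1}, {0,1}, 𝕋. -/
instance : TopologicalSpace TT :=
  generateFrom {{TT.digit false}, {TT.digit true}}

/-- The pointwise order ⊑ on 𝕋^ω (⊥ ⊑ 0, ⊥ ⊑ 1, digits incomparable). -/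
def TLe (p q : ℕ → TT) : Prop := ∀ k (b : Bool), p k = TT.digit b → q k = TT.digit b

/-- Compatibility in 𝕋^ω: existence of a common upper bound. -/
def TCompat (p q : ℕ → TT) : Prop := ∃ r, TLe p r ∧ TLe q r

/-- dom(p) = the set of positions where p has a digit. -/
def Tdom (p : ℕ → TT) : Set ℕ := {k | p k ≠ TT.bot}

/-- p is a finite bottomed sequence (an element of 𝕋^*). -/
def TFin (p : ℕ → TT) : Prop := (Tdom p).Finite

/-- The truncation p|_n. -/
def trunc (p : ℕ → TT) (n : ℕ) : ℕ → TT := fun k => if k < n then p k else TT.bot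

/-- The pointwise least upper bound of two (compatible) bottomed sequences. -/
def tsup (d e : ℕ → TT) : ℕ → TT := fun k => if d k = TT.bot then e k else d k

/-- A dyadic subbase of X: a family of regular open sets, pairwise exteriors,
forming a subbase of the topology of X. -/
structure DyadicSubbase (X : Type*) [t : TopologicalSpace X] where
  S : ℕ → Bool → Set X
  regOpen : ∀ n a, S n a = interior (closure (S n a))
  compl : ∀ n, S n true = (closure (S n false))ᶜ
  subbase : generateFrom {U | ∃ n a, U = S n a} = t

variable {X : Type*} [TopologicalSpace X]

open Classical in
/-- The embedding φ_S : X → 𝕋^ω. -/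
noncomputable def phi (D : DyadicSubbase X) (x : X) : ℕ → TT := fun n =>
  if x ∈ D.S n false then TT.digit false
  else if x ∈ D.S n true then TT.digit true
  else TT.bot

/-- S(p) = ⋂_{k ∈ dom p} S_{k, p(k)}. -/
def Sint (D : DyadicSubbase X) (p : ℕ → TT) : Set X :=
  {x | ∀ k (b : Bool), p k = TT.digit b → x ∈ D.S k b}

/-- S̄(p) = ⋂_{k ∈ dom p} cl(S_{k, p(k)}). -/
def SbarInt (D : DyadicSubbase X) (p : ℕ → TT) : Set X :=
  {x | ∀ k (b : Bool), p k = TT.digit b → x ∈ closure (D.S k b)}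

/-- S is a proper dyadic subbase: cl(S(e)) = S̄(e) for all finite bottomed e. -/
def IsProperDS (D : DyadicSubbase X) : Prop :=
  ∀ e, TFin e → closure (Sint D e) = SbarInt D e

/-- ↑X̃ = {p : x̃ ⊑ p for some x}. -/
def upX (D : DyadicSubbase X) : Set (ℕ → TT) := {p | ∃ x, TLe (phi D x) p}

/-- 2^ω, the bottom-free sequences. -/
def twoOmega : Set (ℕ → TT) := {p | ∀ k, p k ≠ TT.bot}

/-- K_S = {x̃|_m : x ∈ X, m ∈ ℕ}. -/
def KS (D : DyadicSubbase X) : Set (ℕ → TT) := {e | ∃ x m, e = trunc (phi D x) m}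

/-- K̂_S = {p|_m : p ∈ ↑X̃, m ∈ ℕ}. -/
def KhatS (D : DyadicSubbase X) : Set (ℕ → TT) := {e | ∃ p ∈ upX D, ∃ m, e = trunc p m}

/-- I is an ideal of the subposet K of 𝕋^ω. -/
def IsIdealOf (K I : Set (ℕ → TT)) : Prop :=
  I ⊆ K ∧ I.Nonempty ∧ (∀ d ∈ I, ∀ e ∈ I, ∃ f ∈ I, TLe d f ∧ TLe e f) ∧
    (∀ d ∈ K, ∀ e ∈ I, TLe d e → d ∈ I)

/-- p is the pointwise least upper bound of the set I in 𝕋^ω. -/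
def IsSupOf (I : Set (ℕ → TT)) (p : ℕ → TT) : Prop :=
  ∀ k (b : Bool), p k = TT.digit b ↔ ∃ e ∈ I, e k = TT.digit b

/-- D_S ⊆ 𝕋^ω: least upper bounds of ideals of K_S. -/
def DS (D : DyadicSubbase X) : Set (ℕ → TT) := {p | ∃ I, IsIdealOf (KS D) I ∧ IsSupOf I p}

/-- D̂_S ⊆ 𝕋^ω: least upper bounds of ideals of K̂_S. -/
def DhatS (D : DyadicSubbase X) : Set (ℕ → TT) := {p | ∃ I, IsIdealOf (KhatS D) I ∧ IsSupOf I p}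

/-- The limit (non-compact) elements of a subdomain E of 𝕋^ω:
those with infinite domain. -/
def limitsOf (E : Set (ℕ → TT)) : Set (ℕ → TT) := {p ∈ E | (Tdom p).Infinite}

/-- The minimal elements of a subset A of 𝕋^ω. -/
def minOf (A : Set (ℕ → TT)) : Set (ℕ → TT) := {p ∈ A | ∀ q ∈ A, TLe q p → q = p}

/-- q is an immediate successor of p in the subposet K of 𝕋^ω. -/
def ImmSucc (K : Set (ℕ → TT)) (p q : ℕ → TT) : Prop :=
  p ∈ K ∧ q ∈ K ∧ TLe p q ∧ p ≠ q ∧ ¬∃ r ∈ K, TLe p r ∧ p ≠ r ∧ TLe r q ∧ r ≠ q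

/-- A Hausdorff space is adhesive if it has at least two points and the closures
of any two nonempty open sets intersect. -/
def Adhesive (Y : Type*) [TopologicalSpace Y] : Prop :=
  (∃ y z : Y, y ≠ z) ∧
    ∀ U V : Set Y, IsOpen U → IsOpen V → U.Nonempty → V.Nonempty →
      (closure U ∩ closure V).Nonempty

/-- A space is strongly nonadhesive if every open subspace is nonadhesive. -/
def StronglyNonadhesive (Y : Type*) [TopologicalSpace Y] : Prop :=
  ∀ U : Set Y, IsOpen U → ¬ Adhesive U
theorem aux_open {V : Set TT} (hV : IsOpen V) (hb : TT.bot ∈ V) : V = Set.univ := by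
  induction hV with
  | basic s hs =>
    rcases hs with rfl | hs
    · simp at hb
    · rw [Set.mem_singleton_iff] at hs
      subst hs
      simp at hb
  | univ => rfl
  | inter s t _ _ hs ht => rw [hs hb.1, ht hb.2, Set.univ_inter]
  | sUnion S _ ih =>
    obtain ⟨s, hs, hbs⟩ := hb
    have h := ih s hs hbs
    exact Set.eq_univ_of_univ_subset (h ▸ Set.subset_sUnion_of_mem hs)

theorem aux_closure {A : Set (ℕ → TT)} {p : ℕ → TT}
    (h : ∀ I : Finset ℕ, ∃ q ∈ A, ∀ k ∈ I, ∀ b, p k = TT.digit b → q k = TT.digit b) :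
    p ∈ closure A := by
  rw [mem_closure_iff]
  intro U hU hp
  obtain ⟨I, u, hu, hsub⟩ := isOpen_pi_iff.1 hU p hp
  obtain ⟨q, hqA, hq⟩ := h I
  refine ⟨q, hsub ?_, hqA⟩
  intro k hk
  obtain ⟨ho, hm⟩ := hu k hk
  cases hpk : p k with
  | bot =>
    rw [hpk] at hm
    rw [aux_open ho hm]
    trivial
  | digit b =>
    rw [hq k hk b hpk, ← hpk]
    exact hm

theorem aux_ideal {K I : Set (ℕ → TT)} {p : ℕ → TT} (hI : IsIdealOf K I) (hp : IsSupOf I p)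
    (J : Finset ℕ) : ∃ e ∈ I, ∀ k ∈ J, ∀ b, p k = TT.digit b → e k = TT.digit b := by
  classical
  obtain ⟨_, ⟨e0, he0⟩, hdir, _⟩ := hI
  induction J using Finset.induction_on with
  | empty => exact ⟨e0, he0, by simp⟩
  | insert a s _ ih =>
    obtain ⟨e, he, hes⟩ := ih
    cases hpa : p a with
    | bot =>
      refine ⟨e, he, ?_⟩
      intro k hk b hb
      rcases Finset.mem_insert.1 hk with rfl | hk
      · rw [hpa] at hb
        cases hb
      · exact hes k hk b hb
    | digit c =>
      obtain ⟨d, hd, hda⟩ := (hp a c).1 hpa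
      obtain ⟨f, hf, hef, hdf⟩ := hdir e he d hd
      refine ⟨f, hf, ?_⟩
      intro k hk b hb
      rcases Finset.mem_insert.1 hk with rfl | hk
      · rw [hpa] at hb
        rw [← hb]
        exact hdf k c hda
      · exact hef k b (hes k hk b hb)

theorem aux_range {K : Set (ℕ → TT)} {p : ℕ → TT} (h1 : ∀ m, trunc p m ∈ K)
    (h2 : ∀ e ∈ K, ∃ q m, e = trunc q m) :
    ∃ I, IsIdealOf K I ∧ IsSupOf I p := by
  have ht : ∀ m, TLe (trunc p m) p := by
    intro m k b h
    unfold trunc at h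
    split_ifs at h
    exact h
  have hb : ∀ q m n, m ≤ n → TLe (trunc q m) p → TLe (trunc q m) (trunc p n) := by
    intro q m n hmn h k b hk
    have := h k b hk
    unfold trunc at hk ⊢
    split_ifs at hk with hkm
    rw [if_pos (by omega)]
    exact this
  refine ⟨{e | e ∈ K ∧ TLe e p}, ⟨fun e he => he.1, ⟨_, h1 0, ht 0⟩, ?_, ?_⟩, ?_⟩
  · rintro d ⟨hd, hdp⟩ e ⟨he, hep⟩
    obtain ⟨q, m, rfl⟩ := h2 d hd
    obtain ⟨r, n, rfl⟩ := h2 e he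
    exact ⟨trunc p (max m n), ⟨h1 _, ht _⟩, hb _ _ _ (le_max_left _ _) hdp,
      hb _ _ _ (le_max_right _ _) hep⟩
  · rintro d hd e ⟨_, hep⟩ hde
    exact ⟨hd, fun k b h => hep k b (hde k b h)⟩
  · intro k b
    constructor
    · intro h
      exact ⟨trunc p (k+1), ⟨h1 _, ht _⟩, by simp [trunc, h]⟩
    · rintro ⟨e, ⟨_, he⟩, hk⟩
      exact he k b hk

theorem aux_compl {X : Type*} [TopologicalSpace X] (D : DyadicSubbase X) (n : ℕ) (b : Bool) :
    D.S n (!b) = (closure (D.S n b))ᶜ := by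
  cases b with
  | false => exact D.compl n
  | true =>
    have h := D.regOpen n false
    rw [D.compl n, closure_compl, compl_compl]
    exact h

theorem aux_phi {X : Type*} [TopologicalSpace X] (D : DyadicSubbase X) {x : X} {n : ℕ} {b : Bool}
    (h : x ∈ D.S n b) : phi D x n = TT.digit b := by
  cases b with
  | false => simp [phi, h]
  | true =>
    have h' : x ∉ D.S n false := by
      intro h2
      rw [D.compl n] at h
      exact h (subset_closure h2)
    simp [phi, h, h']

/-- Proposition 4.2: (i) X̃ is dense in D_S; (ii) if S is proper, X̃ is dense in D̂_S. -/
theorem stmt_7 {X : Type*} [TopologicalSpace X] [T2Space X] [SecondCountableTopology X]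
    (D : DyadicSubbase X) :
    (Set.range (phi D) ⊆ DS D ∧ DS D ⊆ closure (Set.range (phi D))) ∧
    (IsProperDS D →
      Set.range (phi D) ⊆ DhatS D ∧ DhatS D ⊆ closure (Set.range (phi D))) := by
  refine ⟨⟨?_, ?_⟩, fun hP => ⟨?_, ?_⟩⟩
  · rintro _ ⟨x, rfl⟩
    exact aux_range (fun m => ⟨x, m, rfl⟩) (fun e ⟨y, m, h⟩ => ⟨_, m, h⟩)
  · rintro p ⟨I, hI, hp⟩
    refine aux_closure fun J => ?_
    obtain ⟨e, he, h⟩ := aux_ideal hI hp J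
    obtain ⟨x, m, rfl⟩ := hI.1 he
    refine ⟨_, ⟨x, rfl⟩, fun k hk b hb => ?_⟩
    have := h k hk b hb
    unfold trunc at this
    split_ifs at this
    exact this
  · rintro _ ⟨x, rfl⟩
    exact aux_range (fun m => ⟨phi D x, ⟨x, fun _ _ h => h⟩, m, rfl⟩)
      (fun e ⟨q, _, m, h⟩ => ⟨q, m, h⟩)
  · rintro p ⟨I, hI, hp⟩
    refine aux_closure fun J => ?_
    obtain ⟨e, he, h⟩ := aux_ideal hI hp J
    obtain ⟨q, ⟨x, hx⟩, m, rfl⟩ := hI.1 he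
    have hfin : TFin (trunc q m) := by
      refine (Set.finite_lt_nat m).subset ?_
      intro k hk
      by_contra hkm
      exact hk (if_neg hkm)
    have hxm : x ∈ SbarInt D (trunc q m) := by
      intro k b hk
      unfold trunc at hk
      split_ifs at hk
      by_contra hc
      have h1 : x ∈ D.S k (!b) := by
        rw [aux_compl]
        exact hc
      have h2 := hx k _ (aux_phi D h1)
      rw [hk] at h2
      cases b <;> simp at h2
    rw [← hP _ hfin] at hxm
    obtain ⟨y, hy⟩ := closure_nonempty_iff.1 ⟨x, hxm⟩
    exact ⟨_, ⟨y, rfl⟩, fun k hk b hb => aux_phi D (hy k b (h k hk b hb))⟩
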